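/- arXiv:2204.10605 — 2 statements merged into one kernel-verified Lean document; each statement's English description precedes it below -/
import Mathlib

section
/- Under the stated setup, for every agent i ∈ {1,…,m} and every k ≥ 1 one has ‖x̄_i^k − x_i^k‖ ≤ (4ρ̄ + 7C_p) γ_k. -/
/-- The barycentre of a finite family of vectors. -/
noncomputable def familyMean {m : ℕ} {E : Type*} [AddCommGroup E] [Module ℝ E]
    (z : Fin m → E) : E :=
  (m : ℝ)⁻¹ • ∑ i, z i

/-- The deviations of a finite family from its barycentre, as an element of the `ℓ²` product. -/
noncomputable def deviation {m : ℕ} {E : Type*} [AddCommGroup E] [Module ℝ E]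
    (z : Fin m → E) : PiLp 2 (fun _ : Fin m => E) :=
  WithLp.toLp 2 fun i => z i - familyMean z

/-- The family of linear combinations of `z` with coefficients the rows of `W`. -/
def mix {m : ℕ} {E : Type*} [AddCommGroup E] [Module ℝ E]
    (W : Matrix (Fin m) (Fin m) ℝ) (z : Fin m → E) : Fin m → E :=
  fun i => ∑ j, W i j • z j

section Module

variable {m : ℕ} {E : Type*} [AddCommGroup E] [Module ℝ E]

theorem familyMean_add_smul (a b : ℝ) (z w : Fin m → E) :
    familyMean (fun i => a • z i + b • w i) = a • familyMean z + b • familyMean w := by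
  simp only [familyMean, Finset.sum_add_distrib, ← Finset.smul_sum, smul_add]
  rw [smul_comm _ a, smul_comm _ b]

theorem deviation_add_smul (a b : ℝ) (z w : Fin m → E) :
    deviation (fun i => a • z i + b • w i) = a • deviation z + b • deviation w := by
  ext i
  change a • z i + b • w i - familyMean (fun i => a • z i + b • w i) =
    a • (z i - familyMean z) + b • (w i - familyMean w)
  rw [familyMean_add_smul, smul_sub, smul_sub]
  abel

theorem sum_deviation (hm : 0 < m) (z : Fin m → E) : ∑ i, deviation z i = 0 := by
  have h : (m : ℝ) ≠ 0 := by positivity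
  simp [deviation, familyMean, ← Nat.cast_smul_eq_nsmul ℝ, smul_smul, h]

theorem familyMean_mix {W : Matrix (Fin m) (Fin m) ℝ} (hcol : ∀ j, ∑ i, W i j = 1)
    (z : Fin m → E) : familyMean (mix W z) = familyMean z := by
  simp only [familyMean, mix]
  rw [Finset.sum_comm]
  simp only [← Finset.sum_smul, hcol, one_smul]

theorem deviation_mix {W : Matrix (Fin m) (Fin m) ℝ} (hrow : ∀ i, ∑ j, W i j = 1)
    (hcol : ∀ j, ∑ i, W i j = 1) (z : Fin m → E) :
    deviation (mix W z) = WithLp.toLp 2 (mix W (deviation z)) := by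
  ext i
  simp only [deviation, familyMean_mix hcol, mix, smul_sub, Finset.sum_sub_distrib,
    ← Finset.sum_smul, hrow, one_smul]

theorem mix_mem {W : Matrix (Fin m) (Fin m) ℝ} (hnn : ∀ i j, 0 ≤ W i j)
    (hrow : ∀ i, ∑ j, W i j = 1) {Ω : Set E} (hΩ : Convex ℝ Ω) {z : Fin m → E}
    (hz : ∀ i, z i ∈ Ω) (i : Fin m) : mix W z i ∈ Ω :=
  hΩ.sum_mem (fun j _ => hnn i j) (hrow i) fun j _ => hz j

theorem familyMean_mem (hm : 0 < m) {Ω : Set E} (hΩ : Convex ℝ Ω) {z : Fin m → E}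
    (hz : ∀ i, z i ∈ Ω) : familyMean z ∈ Ω := by
  have h : (m : ℝ) ≠ 0 := by positivity
  rw [familyMean, Finset.smul_sum]
  exact hΩ.sum_mem (fun _ _ => by positivity) (by simp [h]) fun j _ => hz j

end Module

section Normed

variable {m : ℕ} {E : Type*} [NormedAddCommGroup E] [NormedSpace ℝ E]

theorem norm_deviation_apply_le (hm : 0 < m) {Ω : Set E} (hΩ : Convex ℝ Ω)
    (hb : Bornology.IsBounded Ω) {z : Fin m → E} (hz : ∀ i, z i ∈ Ω) (i : Fin m) :
    ‖deviation z i‖ ≤ Metric.diam Ω := by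
  have h := Metric.dist_le_diam_of_mem hb (hz i) (familyMean_mem hm hΩ hz)
  rwa [dist_eq_norm] at h

theorem norm_deviation_le (hm : 0 < m) {Ω : Set E} (hΩ : Convex ℝ Ω)
    (hb : Bornology.IsBounded Ω) {z : Fin m → E} (hz : ∀ i, z i ∈ Ω) :
    ‖deviation z‖ ≤ Real.sqrt m * Metric.diam Ω := by
  refine le_of_pow_le_pow_left₀ two_ne_zero (mul_nonneg (Real.sqrt_nonneg _) Metric.diam_nonneg) ?_
  rw [PiLp.norm_sq_eq_of_L2, mul_pow, Real.sq_sqrt (Nat.cast_nonneg m)]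
  calc ∑ i, ‖deviation z i‖ ^ 2 ≤ ∑ _i : Fin m, Metric.diam Ω ^ 2 := by
        gcongr with i
        exact norm_deviation_apply_le hm hΩ hb hz i
    _ = m * Metric.diam Ω ^ 2 := by simp

end Normed

/-- A contraction estimate on mean-zero scalar families holds for mean-zero vector families. -/
theorem norm_mix_le {d m : ℕ} {W : Matrix (Fin m) (Fin m) ℝ} {lam : ℝ} (hlam : 0 ≤ lam)
    (hW : ∀ y : Fin m → ℝ, ∑ i, y i = 0 →
      Real.sqrt (∑ i, (∑ j, W i j * y j) ^ 2) ≤ lam * Real.sqrt (∑ i, (y i) ^ 2))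
    (y : PiLp 2 (fun _ : Fin m => EuclideanSpace ℝ (Fin d))) (hy : ∑ i, y i = 0) :
    ‖WithLp.toLp 2 (mix W y)‖ ≤ lam * ‖y‖ := by
  refine le_of_pow_le_pow_left₀ two_ne_zero (by positivity) ?_
  rw [mul_pow, PiLp.norm_sq_eq_of_L2, PiLp.norm_sq_eq_of_L2]
  simp only [EuclideanSpace.real_norm_sq_eq]
  rw [Finset.sum_comm, Finset.sum_comm (f := fun i c => y i c ^ 2), Finset.mul_sum]
  refine Finset.sum_le_sum fun c _ => ?_
  have hc : ∑ i, y i c = 0 := by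
    simpa using congrArg (fun v : EuclideanSpace ℝ (Fin d) => v c) hy
  have h := pow_le_pow_left₀ (Real.sqrt_nonneg _) (hW (fun i => y i c) hc) 2
  rw [mul_pow, Real.sq_sqrt (by positivity), Real.sq_sqrt (by positivity)] at h
  simpa [mix] using h

theorem norm_deviation_mix_le {d m : ℕ} (hm : 0 < m) {W : Matrix (Fin m) (Fin m) ℝ}
    (hrow : ∀ i, ∑ j, W i j = 1) (hcol : ∀ j, ∑ i, W i j = 1) {lam : ℝ} (hlam : 0 ≤ lam)
    (hW : ∀ y : Fin m → ℝ, ∑ i, y i = 0 →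
      Real.sqrt (∑ i, (∑ j, W i j * y j) ^ 2) ≤ lam * Real.sqrt (∑ i, (y i) ^ 2))
    (z : Fin m → EuclideanSpace ℝ (Fin d)) :
    ‖deviation (mix W z)‖ ≤ lam * ‖deviation z‖ := by
  rw [deviation_mix hrow hcol]
  exact norm_mix_le hlam hW _ (sum_deviation hm z)

theorem rpow_neg_le_two_mul_succ_rpow_neg {α : ℝ} (h0 : 0 ≤ α) (h1 : α ≤ 1) {k : ℕ} (hk : 1 ≤ k) :
    (k : ℝ) ^ (-α) ≤ 2 * ((k + 1 : ℕ) : ℝ) ^ (-α) := by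
  have hk' : (1 : ℝ) ≤ k := by exact_mod_cast hk
  have h2 : (2 : ℝ) ^ α ≤ 2 := by
    simpa using Real.rpow_le_rpow_of_exponent_le (x := 2) (by norm_num) h1
  have h : ((k + 1 : ℕ) : ℝ) ^ α ≤ 2 * (k : ℝ) ^ α :=
    calc ((k + 1 : ℕ) : ℝ) ^ α ≤ (2 * k) ^ α := by
          apply Real.rpow_le_rpow (by positivity) _ h0
          push_cast
          linarith
      _ = 2 ^ α * (k : ℝ) ^ α := Real.mul_rpow (by norm_num) (by positivity)
      _ ≤ 2 * (k : ℝ) ^ α := by gcongr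
  have ha : 0 < (k : ℝ) ^ α := by positivity
  have hb : 0 < ((k + 1 : ℕ) : ℝ) ^ α := by positivity
  rw [Real.rpow_neg (by positivity), Real.rpow_neg (by positivity), ← div_eq_mul_inv,
    le_div_iff₀ hb, inv_mul_le_iff₀ ha]
  linarith

theorem div_succ_rpow_mul_rpow_neg_le {α : ℝ} (h0 : 0 ≤ α) {k₀ k : ℕ} (hk₀ : 1 ≤ k₀)
    (hk : k₀ ≤ k) :
    ((k₀ : ℝ) / ((k₀ : ℝ) + 1)) ^ α * (k : ℝ) ^ (-α) ≤ ((k + 1 : ℕ) : ℝ) ^ (-α) := by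
  have hk₀' : (1 : ℝ) ≤ k₀ := by exact_mod_cast hk₀
  have hk' : (k₀ : ℝ) ≤ k := by exact_mod_cast hk
  have hkpos : (0 : ℝ) < k := by linarith
  calc ((k₀ : ℝ) / ((k₀ : ℝ) + 1)) ^ α * (k : ℝ) ^ (-α)
      ≤ ((k : ℝ) / ((k : ℝ) + 1)) ^ α * (k : ℝ) ^ (-α) := by
        gcongr ?_ * _
        apply Real.rpow_le_rpow (by positivity) _ h0
        rw [div_le_div_iff₀ (by positivity) (by positivity)]
        linarith
    _ = ((k + 1 : ℕ) : ℝ) ^ (-α) := by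
        have ha : 0 < (k : ℝ) ^ α := by positivity
        rw [Real.div_rpow (by positivity) (by positivity), Real.rpow_neg (by positivity),
          Real.rpow_neg (by positivity)]
        push_cast
        field_simp

theorem local_average_deviation_bound (d m : ℕ) (hm : 0 < m)
    (Ω : Set (EuclideanSpace ℝ (Fin d))) (hne : Ω.Nonempty)
    (hconv : Convex ℝ Ω) (hcomp : IsCompact Ω)
    (ρ : ℝ) (hρ : ρ = Metric.diam Ω)
    (W : Matrix (Fin m) (Fin m) ℝ) (hWnn : ∀ i j, 0 ≤ W i j)
    (hrow : ∀ i, ∑ j, W i j = 1) (hcol : ∀ j, ∑ i, W i j = 1)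
    (lam : ℝ) (hlam0 : 0 ≤ lam) (hlam1 : lam < 1)
    (hW : ∀ y : Fin m → ℝ, ∑ i, y i = 0 →
      Real.sqrt (∑ i, (∑ j, W i j * y j) ^ 2) ≤ lam * Real.sqrt (∑ i, (y i) ^ 2))
    (α : ℝ) (hα0 : 0 < α) (hα1 : α ≤ 1)
    (γ : ℕ → ℝ) (hγ : ∀ k, γ k = (k : ℝ) ^ (-α))
    (k₀ : ℕ) (hk₀ : 1 ≤ k₀)
    (hk₀lam : lam ≤ ((k₀ : ℝ) / ((k₀ : ℝ) + 1)) ^ α * (1 + (k₀ : ℝ) ^ (-α))⁻¹)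
    (Cp : ℝ) (hCp : Cp = (k₀ : ℝ) ^ α * Real.sqrt (m : ℝ) * ρ)
    (x u : Fin m → ℕ → EuclideanSpace ℝ (Fin d))
    (hx1 : ∀ i, x i 1 ∈ Ω) (hu : ∀ i k, 1 ≤ k → u i k ∈ Ω)
    (hrec : ∀ i k, 1 ≤ k →
      x i (k + 1) = (1 - γ k) • (∑ j, W i j • x j k) + γ k • u i k) :
    ∀ i, ∀ k, 1 ≤ k →
      ‖(∑ j, W i j • x j k) - x i k‖ ≤ (4 * ρ + 7 * Cp) * γ k := by
  subst hρ hCp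
  have hγ0 : ∀ k, 0 ≤ γ k := fun k => by
    rw [hγ]
    positivity
  have hγ1 : ∀ k, 1 ≤ k → γ k ≤ 1 := fun k hk => by
    rw [hγ]
    exact Real.rpow_le_one_of_one_le_of_nonpos (by exact_mod_cast hk) (by linarith)
  have hb := hcomp.isBounded
  have hmix : ∀ k, 1 ≤ k → (fun i => x i (k + 1)) =
      fun i => (1 - γ k) • mix W (fun j => x j k) i + γ k • u i k :=
    fun k hk => funext fun i => hrec i k hk
  have hx : ∀ k, 1 ≤ k → ∀ i, x i k ∈ Ω := by
    intro k hk
    induction k, hk using Nat.le_induction with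
    | base => exact hx1
    | succ k hk ih =>
      intro i
      rw [hrec i k hk]
      exact hconv (mix_mem hWnn hrow hconv ih i) (hu i k hk) (by linarith [hγ1 k hk]) (hγ0 k)
        (by ring)
  have hdiam : 0 ≤ Metric.diam Ω := Metric.diam_nonneg
  have hp : 0 < (k₀ : ℝ) ^ α := by positivity
  set C := (k₀ : ℝ) ^ α * Real.sqrt (m : ℝ) * Metric.diam Ω with hC
  have hC0 : 0 ≤ C := by positivity
  have hinv : Real.sqrt (m : ℝ) * Metric.diam Ω = C * (k₀ : ℝ) ^ (-α) := by
    rw [Real.rpow_neg (by positivity), hC]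
    field_simp
  have key : ∀ k, 1 ≤ k → ‖deviation (mix W fun i => x i k)‖ ≤ C * γ k := by
    intro k hk
    have small : ∀ k, 1 ≤ k → k ≤ k₀ → ‖deviation (mix W fun i => x i k)‖ ≤ C * γ k := by
      intro k hk hkk
      refine (norm_deviation_le hm hconv hb (mix_mem hWnn hrow hconv (hx k hk))).trans ?_
      rw [hinv, hγ]
      exact mul_le_mul_of_nonneg_left (Real.rpow_le_rpow_of_nonpos (by exact_mod_cast hk)
        (by exact_mod_cast hkk) (by linarith)) hC0
    induction k, hk using Nat.le_induction with
    | base => exact small 1 le_rfl hk₀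
    | succ k hk ih =>
      rcases Nat.lt_or_ge k k₀ with hlt | hge
      · exact small _ (by omega) hlt
      · have hU := norm_deviation_le hm hconv hb fun i => hu i k hk
        have hq : 0 < 1 + (k₀ : ℝ) ^ (-α) := by positivity
        have hstep : ‖deviation fun i => x i (k + 1)‖ ≤ C * γ k * (1 + (k₀ : ℝ) ^ (-α)) := by
          rw [hmix k hk, deviation_add_smul]
          refine (norm_add_le _ _).trans ?_
          rw [norm_smul, norm_smul, Real.norm_of_nonneg (by linarith [hγ1 k hk]),
            Real.norm_of_nonneg (hγ0 k)]
          have h1 : (1 - γ k) * ‖deviation (mix W fun i => x i k)‖ ≤ C * γ k :=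
            (mul_le_of_le_one_left (norm_nonneg _) (by linarith [hγ0 k])).trans ih
          have h2 := mul_le_mul_of_nonneg_left (hU.trans_eq hinv) (hγ0 k)
          linarith
        calc ‖deviation (mix W fun i => x i (k + 1))‖
            ≤ lam * ‖deviation fun i => x i (k + 1)‖ :=
              norm_deviation_mix_le hm hrow hcol hlam0 hW _
          _ ≤ (((k₀ : ℝ) / ((k₀ : ℝ) + 1)) ^ α * (1 + (k₀ : ℝ) ^ (-α))⁻¹) *
                (C * γ k * (1 + (k₀ : ℝ) ^ (-α))) := by gcongr
          _ = C * (((k₀ : ℝ) / ((k₀ : ℝ) + 1)) ^ α * (k : ℝ) ^ (-α)) := by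
              rw [hγ]
              field_simp
          _ ≤ C * γ (k + 1) := by
              rw [hγ]
              exact mul_le_mul_of_nonneg_left
                (div_succ_rpow_mul_rpow_neg_le hα0.le hk₀ hge) hC0
  have keyi : ∀ i k, 1 ≤ k → ‖deviation (mix W fun i => x i k) i‖ ≤ C * γ k :=
    fun i k hk => (PiLp.norm_apply_le _ i).trans (key k hk)
  have hloc : ∀ i k, 1 ≤ k →
      ‖deviation (fun i => x i k) i‖ ≤ (2 * Metric.diam Ω + 2 * C) * γ k := by
    intro i k hk
    obtain rfl | ⟨n, hn, rfl⟩ : k = 1 ∨ ∃ n, 1 ≤ n ∧ k = n + 1 := by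
      rcases hk.eq_or_lt with h | h
      · exact Or.inl h.symm
      · exact Or.inr ⟨k - 1, by omega, by omega⟩
    · have h := norm_deviation_apply_le hm hconv hb hx1 i
      have h1 : γ 1 = 1 := by simp [hγ]
      rw [h1]
      linarith
    · have hU := norm_deviation_apply_le hm hconv hb (fun i => hu i n hn) i
      have h2 : γ n ≤ 2 * γ (n + 1) := by
        rw [hγ, hγ]
        exact rpow_neg_le_two_mul_succ_rpow_neg hα0.le hα1 hn
      rw [hmix n hn, deviation_add_smul, PiLp.add_apply, PiLp.smul_apply, PiLp.smul_apply]
      refine (norm_add_le _ _).trans ?_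
      rw [norm_smul, norm_smul, Real.norm_of_nonneg (by linarith [hγ1 n hn]),
        Real.norm_of_nonneg (hγ0 n)]
      have h3 : (1 - γ n) * ‖deviation (mix W fun i => x i n) i‖ ≤ C * γ n :=
        (mul_le_of_le_one_left (norm_nonneg _) (by linarith [hγ0 n])).trans (keyi i n hn)
      have h4 := mul_le_mul_of_nonneg_left hU (hγ0 n)
      have h5 := mul_le_mul_of_nonneg_left h2 (add_nonneg hdiam hC0)
      linarith
  intro i k hk
  have hsplit : (∑ j, W i j • x j k) - x i k =
      deviation (mix W fun i => x i k) i - deviation (fun i => x i k) i := by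
    simp [deviation, familyMean_mix hcol, mix]
  rw [hsplit]
  refine (norm_sub_le _ _).trans ?_
  have h1 := keyi i k hk
  have h2 := hloc i k hk
  have h3 := mul_nonneg hdiam (hγ0 k)
  have h4 := mul_nonneg hC0 (hγ0 k)
  linarith
end

section
/- Fix α ∈ (0,1], γ_k := k^{−α}, λ ∈ [0,1), and a positive integer k₀ with λ ≤ (k₀/(k₀+1))^α · (1 + k₀^{−α})^{−1}. Let W be an m×m doubly stochastic matrix with nonnegative entries such that ‖W y‖ ≤ λ‖y‖ for every y ∈ ℝ^m with Σ_{i=1}^m y_i = 0. Let k ≥ k₀ be an integer, let C > 0, let d_1, …, d_m and σ_1, …, σ_m be vectors in ℝ^p with averages d̄ := (1/m)Σ_i d_i and σ̄ := (1/m)Σ_i σ_i, and define d_i⁺ := Σ_{j=1}^m W_{ij}(d_j + σ_j), whose average is d̄⁺ = d̄ + σ̄. If √(Σ_{i=1}^m ‖d_i − d̄‖²) ≤ C γ_k and √(Σ_{i=1}^m ‖σ_i − σ̄‖²) ≤ C k₀^{−α} γ_k, then √(Σ_{i=1}^m ‖d_i⁺ − d̄⁺‖²) ≤ C γ_{k+1}.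 (This is the induction step showing that the gradient-tracking deviation stays bounded by C γ_k for all k.) -/
/-- A contraction estimate for a matrix on mean-zero real vectors extends coordinatewise to
mean-zero families of Euclidean vectors. -/
theorem sqrt_sum_norm_sq_mulVec_le {ι κ : Type*} [Fintype ι] [Fintype κ]
    {W : Matrix ι ι ℝ} {lam : ℝ} (hlam : 0 ≤ lam)
    (hW : ∀ y : ι → ℝ, ∑ i, y i = 0 →
      Real.sqrt (∑ i, (∑ j, W i j * y j) ^ 2) ≤ lam * Real.sqrt (∑ i, (y i) ^ 2))
    {z : ι → EuclideanSpace ℝ κ} (hz : ∑ i, z i = 0) :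
    Real.sqrt (∑ i, ‖∑ j, W i j • z j‖ ^ 2) ≤ lam * Real.sqrt (∑ i, ‖z i‖ ^ 2) := by
  have key : ∑ i, ‖∑ j, W i j • z j‖ ^ 2 ≤ lam ^ 2 * ∑ i, ‖z i‖ ^ 2 := by
    simp only [EuclideanSpace.real_norm_sq_eq]
    rw [Finset.sum_comm, Finset.sum_comm (f := fun i l => z i l ^ 2), Finset.mul_sum]
    refine Finset.sum_le_sum fun l _ => ?_
    have hl : ∑ i, z i l = 0 := by
      simpa using congrArg (fun v : EuclideanSpace ℝ κ => v l) hz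
    have h := pow_le_pow_left₀ (Real.sqrt_nonneg _) (hW (fun i => z i l) hl) 2
    rw [mul_pow, Real.sq_sqrt (by positivity), Real.sq_sqrt (by positivity)] at h
    simpa using h
  calc Real.sqrt (∑ i, ‖∑ j, W i j • z j‖ ^ 2)
      ≤ Real.sqrt (lam ^ 2 * ∑ i, ‖z i‖ ^ 2) := Real.sqrt_le_sqrt key
    _ = lam * Real.sqrt (∑ i, ‖z i‖ ^ 2) := by
      rw [Real.sqrt_mul (sq_nonneg _), Real.sqrt_sq hlam]

/-- Minkowski's inequality for the `ℓ²` norm of a finite family of vectors. -/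
theorem sqrt_sum_norm_add_sq_le {ι E : Type*} [Fintype ι] [SeminormedAddCommGroup E]
    (x y : ι → E) :
    Real.sqrt (∑ i, ‖x i + y i‖ ^ 2) ≤
      Real.sqrt (∑ i, ‖x i‖ ^ 2) + Real.sqrt (∑ i, ‖y i‖ ^ 2) := by
  simpa [PiLp.norm_eq_of_L2] using norm_add_le (WithLp.toLp 2 x) (WithLp.toLp 2 y)

/-- The deviations of a finite family from its average sum to zero. -/
theorem sum_sub_average_eq_zero {E : Type*} [AddCommGroup E] [Module ℝ E] {m : ℕ}
    (x : Fin m → E) : ∑ i, (x i - (m : ℝ)⁻¹ • ∑ j, x j) = 0 := by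
  rcases Nat.eq_zero_or_pos m with rfl | hm
  · simp
  · have hm' : (m : ℝ) ≠ 0 := by positivity
    rw [Finset.sum_sub_distrib, Finset.sum_const, Finset.card_univ, Fintype.card_fin,
      ← Nat.cast_smul_eq_nsmul ℝ, smul_smul, mul_inv_cancel₀ hm', one_smul, sub_self]

/-- The ratio `(a / (a + 1)) ^ α` is at most the decay ratio of `x ^ (-α)` from `b` to `b + 1`
whenever `a ≤ b`. -/
theorem div_add_one_rpow_mul_rpow_neg_le {a b α : ℝ} (ha : 0 < a) (hab : a ≤ b) (hα : 0 ≤ α) :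
    (a / (a + 1)) ^ α * b ^ (-α) ≤ (b + 1) ^ (-α) := by
  have hb : 0 < b := ha.trans_le hab
  have hle : a / (a + 1) ≤ b / (b + 1) := by
    rw [div_le_div_iff₀ (by positivity) (by positivity)]
    nlinarith
  calc (a / (a + 1)) ^ α * b ^ (-α) ≤ (b / (b + 1)) ^ α * b ^ (-α) := by gcongr
    _ = (b + 1) ^ (-α) := by
      have := (Real.rpow_pos_of_pos hb α).ne'
      rw [Real.div_rpow hb.le (by positivity), Real.rpow_neg hb.le, Real.rpow_neg (by positivity)]
      field_simp

/-- Induction step for the gradient-tracking deviation bound: if the current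
deviations satisfy `√(Σ_i ‖d_i − d̄‖²) ≤ C γ_k` and
`√(Σ_i ‖σ_i − σ̄‖²) ≤ C k₀^{−α} γ_k`, then after one averaging step with the
doubly stochastic matrix `W` (with contraction factor `λ` on mean-zero
vectors), the new deviations satisfy `√(Σ_i ‖d_i⁺ − d̄⁺‖²) ≤ C γ_{k+1}`. -/
theorem tracking_induction_step (m p : ℕ)
    (α : ℝ) (hα0 : 0 < α) (hα1 : α ≤ 1)
    (lam : ℝ) (hlam0 : 0 ≤ lam) (hlam1 : lam < 1)
    (γ : ℕ → ℝ) (hγ : ∀ k : ℕ, γ k = (k : ℝ) ^ (-α))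
    (k₀ : ℕ) (hk₀ : 1 ≤ k₀)
    (hk₀lam : lam ≤ ((k₀ : ℝ) / ((k₀ : ℝ) + 1)) ^ α * (1 + (k₀ : ℝ) ^ (-α))⁻¹)
    (W : Matrix (Fin m) (Fin m) ℝ) (hWnn : ∀ i j, 0 ≤ W i j)
    (hrow : ∀ i, ∑ j, W i j = 1) (hcol : ∀ j, ∑ i, W i j = 1)
    (hW : ∀ y : Fin m → ℝ, ∑ i, y i = 0 →
      Real.sqrt (∑ i, (∑ j, W i j * y j) ^ 2) ≤ lam * Real.sqrt (∑ i, (y i) ^ 2))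
    (k : ℕ) (hk : k₀ ≤ k) (C : ℝ) (hC : 0 < C)
    (dd σ : Fin m → EuclideanSpace ℝ (Fin p))
    (hd : Real.sqrt (∑ i, ‖dd i - (m : ℝ)⁻¹ • ∑ j, dd j‖ ^ 2) ≤ C * γ k)
    (hσ : Real.sqrt (∑ i, ‖σ i - (m : ℝ)⁻¹ • ∑ j, σ j‖ ^ 2) ≤
      C * (k₀ : ℝ) ^ (-α) * γ k) :
    Real.sqrt (∑ i, ‖(∑ j, W i j • (dd j + σ j)) -
        ((m : ℝ)⁻¹ • ∑ j, dd j + (m : ℝ)⁻¹ • ∑ j, σ j)‖ ^ 2) ≤ C * γ (k + 1) := by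
  have hk₀pos : (0 : ℝ) < k₀ := by exact_mod_cast hk₀
  have hkk : (k₀ : ℝ) ≤ k := by exact_mod_cast hk
  set u : Fin m → EuclideanSpace ℝ (Fin p) := fun i => dd i - (m : ℝ)⁻¹ • ∑ j, dd j with hu
  set v : Fin m → EuclideanSpace ℝ (Fin p) := fun i => σ i - (m : ℝ)⁻¹ • ∑ j, σ j with hv
  have hsum : ∑ i, (u i + v i) = 0 := by
    rw [Finset.sum_add_distrib, hu, hv, sum_sub_average_eq_zero, sum_sub_average_eq_zero, add_zero]
  have hdev : ∀ i, (∑ j, W i j • (dd j + σ j)) -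
      ((m : ℝ)⁻¹ • ∑ j, dd j + (m : ℝ)⁻¹ • ∑ j, σ j) = ∑ j, W i j • (u j + v j) := by
    intro i
    have huv : ∀ j, u j + v j =
        (dd j + σ j) - ((m : ℝ)⁻¹ • ∑ j, dd j + (m : ℝ)⁻¹ • ∑ j, σ j) :=
      fun j => sub_add_sub_comm _ _ _ _
    simp only [huv, smul_sub _ (dd _ + σ _), Finset.sum_sub_distrib, ← Finset.sum_smul, hrow,
      one_smul]
  simp only [hdev]
  have hγk : 0 ≤ C * γ k := by rw [hγ]; positivity
  have hpos : 0 < 1 + (k₀ : ℝ) ^ (-α) := by positivity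
  have hlam : lam * (1 + (k₀ : ℝ) ^ (-α)) ≤ ((k₀ : ℝ) / (k₀ + 1)) ^ α := by
    rwa [← div_eq_mul_inv, le_div_iff₀ hpos] at hk₀lam
  calc Real.sqrt (∑ i, ‖∑ j, W i j • (u j + v j)‖ ^ 2)
      ≤ lam * Real.sqrt (∑ i, ‖u i + v i‖ ^ 2) := sqrt_sum_norm_sq_mulVec_le hlam0 hW hsum
    _ ≤ lam * (C * γ k + C * (k₀ : ℝ) ^ (-α) * γ k) :=
      mul_le_mul_of_nonneg_left
        ((sqrt_sum_norm_add_sq_le u v).trans (add_le_add hd hσ)) hlam0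
    _ = lam * (1 + (k₀ : ℝ) ^ (-α)) * (C * γ k) := by ring
    _ ≤ ((k₀ : ℝ) / (k₀ + 1)) ^ α * (C * γ k) := mul_le_mul_of_nonneg_right hlam hγk
    _ = C * (((k₀ : ℝ) / (k₀ + 1)) ^ α * (k : ℝ) ^ (-α)) := by rw [hγ]; ring
    _ ≤ C * γ (k + 1) := by
      rw [hγ, Nat.cast_add_one]
      exact mul_le_mul_of_nonneg_left
        (div_add_one_rpow_mul_rpow_neg_le hk₀pos hkk hα0.le) hC.le
end
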